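/- Let (p(n))_{n∈ℕ} be an ensemble of probability vectors, where p(n) = (p₁,…,pₙ) satisfies Σᵢpᵢ = 1 and p₁ ≥ p₂ ≥ … ≥ pₙ > 0, and suppose p₁² = Θ(Σ_{i=1}^n pᵢ²) as n → ∞. Then non-uniform random 2-SAT has a coarse satisfiability threshold at m*(n) = (1 − Σ_{i=1}^n pᵢ²)/(p₁·(Σ_{i=2}^n pᵢ²)^{1/2}): (i) if m(n) = o(m*(n)) then Pr(Φ satisfiable) = 1−o(1); (ii) if m(n) = ω(m*(n)) then Pr(Φ satisfiable) = o(1); and (iii) the threshold is not sharp: there exist constants 0 < c₁ ≤ c₂ and a choice m(n) with c₁·m*(n) ≤ m(n) ≤ c₂·m*(n) for which Pr(Φ satisfiable) is bounded away from both 0 and 1 by positive constants. -/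

import Mathlib

open Finset Filter Asymptotics

open scoped Classical

/-- The probability of drawing a given ordered 2-clause (an ordered pair of literals over
distinct variables); an unordered 2-clause over variables `i ≠ j` then has total probability
`(C/2)·pᵢ·pⱼ` where `C = (1 - ∑ pᵢ²)⁻¹`. -/
noncomputable def clauseProb2 (n : ℕ) (p : ℕ → ℝ) (c : (Fin n × Bool) × (Fin n × Bool)) : ℝ :=
  if c.1.1 ≠ c.2.1 then
    (1 - ∑ i ∈ Finset.range n, p i ^ 2)⁻¹ / 4 * p c.1.1.1 * p c.2.1.1
  else 0

/-- The probability of drawing a given formula: `m` clauses drawn independently. -/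
noncomputable def formulaProb2 (n m : ℕ) (p : ℕ → ℝ)
    (Φ : Fin m → (Fin n × Bool) × (Fin n × Bool)) : ℝ :=
  ∏ j, clauseProb2 n p (Φ j)

/-- Satisfiability of a 2-CNF formula: a literal `(x, b)` is satisfied by an assignment `a`
iff `a x = b`. -/
def Sat2 {n m : ℕ} (Φ : Fin m → (Fin n × Bool) × (Fin n × Bool)) : Prop :=
  ∃ a : Fin n → Bool, ∀ j, a (Φ j).1.1 = (Φ j).1.2 ∨ a (Φ j).2.1 = (Φ j).2.2

/-- The probability that a non-uniform random 2-SAT formula with `n` variables, `m` clauses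
and variable distribution `p` is satisfiable. -/
noncomputable def probSat2 (n m : ℕ) (p : ℕ → ℝ) : ℝ :=
  ∑ Φ : Fin m → (Fin n × Bool) × (Fin n × Bool),
    if Sat2 Φ then formulaProb2 n m p Φ else 0

/-- The probability that a non-uniform random 2-SAT formula is unsatisfiable. -/
noncomputable def probUnsat2 (n m : ℕ) (p : ℕ → ℝ) : ℝ :=
  ∑ Φ : Fin m → (Fin n × Bool) × (Fin n × Bool),
    if ¬ Sat2 Φ then formulaProb2 n m p Φ else 0

/-- The normalization constant `C = (1 - ∑ pᵢ²)⁻¹`. -/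
noncomputable def Cconst (n : ℕ) (p : ℕ → ℝ) : ℝ :=
  (1 - ∑ i ∈ Finset.range n, p i ^ 2)⁻¹

/-- The maximum clause probability `q_max = (C/2)·p₁·p₂`. -/
noncomputable def qmax2 (n : ℕ) (p : ℕ → ℝ) : ℝ :=
  Cconst n p / 2 * p 0 * p 1

/-- `p n` is a probability vector on `n` variables (indexed `0,…,n-1`), sorted decreasingly,
with all entries positive. -/
def ProbEnsemble (p : ℕ → ℕ → ℝ) : Prop :=
  ∀ n, 1 ≤ n →
    (∑ i ∈ Finset.range n, p n i = 1) ∧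
    (∀ i j, i ≤ j → j < n → p n j ≤ p n i) ∧
    (∀ i, i < n → 0 < p n i)

/-- The coarse threshold location `m*(n) = (1 - ∑_{i=1}^n pᵢ²) / (p₁·(∑_{i=2}^n pᵢ²)^{1/2})`. -/
noncomputable def mstarCoarse (p : ℕ → ℕ → ℝ) (n : ℕ) : ℝ :=
  (1 - ∑ i ∈ Finset.range n, p n i ^ 2) /
    (p n 0 * Real.sqrt (∑ i ∈ Finset.Ico 1 n, p n i ^ 2))

structure PV (n : ℕ) (p : ℕ → ℝ) : Prop where
  two : 2 ≤ n
  sum : ∑ i ∈ Finset.range n, p i = 1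
  anti : ∀ i j, i ≤ j → j < n → p j ≤ p i
  pos : ∀ i, i < n → 0 < p i

noncomputable def tailS (n : ℕ) (p : ℕ → ℝ) : ℝ := ∑ i ∈ Finset.Ico 1 n, p i ^ 2

noncomputable def defC (n : ℕ) (p : ℕ → ℝ) : ℝ := 1 - ∑ i ∈ Finset.range n, p i ^ 2

lemma PV.sumFin {n : ℕ} {p : ℕ → ℝ} (h : PV n p) : ∑ x : Fin n, p x = 1 := by
  rw [← h.sum, Finset.sum_range]

lemma PV.split {n : ℕ} {p : ℕ → ℝ} (h : PV n p) :
    ∑ i ∈ Finset.range n, p i ^ 2 = p 0 ^ 2 + tailS n p := by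
  have := h.two
  rw [Finset.range_eq_Ico, Finset.sum_eq_sum_Ico_succ_bot (by omega)]
  rfl

lemma PV.tail_pos {n : ℕ} {p : ℕ → ℝ} (h : PV n p) : 0 < tailS n p := by
  apply Finset.sum_pos
  · intro i hi
    have := h.pos i (by simp at hi; omega)
    positivity
  · have := h.two
    exact ⟨1, by simp; omega⟩

lemma PV.p0_pos {n : ℕ} {p : ℕ → ℝ} (h : PV n p) : 0 < p 0 := h.pos 0 (by have := h.two; omega)

lemma PV.sqrt_tail_le {n : ℕ} {p : ℕ → ℝ} (h : PV n p) : Real.sqrt (tailS n p) ≤ 1 - p 0 := by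
  have h2 := h.two
  have h1 : ∑ i ∈ Finset.Ico 1 n, p i = 1 - p 0 := by
    have := h.sum
    rw [Finset.range_eq_Ico, Finset.sum_eq_sum_Ico_succ_bot (by omega)] at this
    simp at this
    linarith
  have hnn : ∀ i ∈ Finset.Ico 1 n, 0 ≤ p i := fun i hi => (h.pos i (by simp at hi; omega)).le
  rw [← h1]
  apply Real.sqrt_le_iff.2
  exact ⟨Finset.sum_nonneg hnn, Finset.sum_sq_le_sq_sum_of_nonneg hnn⟩

lemma PV.defC_ge {n : ℕ} {p : ℕ → ℝ} (h : PV n p) :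
    2 * (p 0 * Real.sqrt (tailS n p)) ≤ defC n p := by
  have h1 := h.sqrt_tail_le
  have h0 := h.p0_pos
  have hs := Real.sq_sqrt h.tail_pos.le
  have hs0 := Real.sqrt_nonneg (tailS n p)
  unfold defC
  rw [h.split]
  nlinarith

lemma PV.sq_pos {n : ℕ} {p : ℕ → ℝ} (h : PV n p) : 0 < p 0 * Real.sqrt (tailS n p) :=
  mul_pos h.p0_pos (Real.sqrt_pos.2 h.tail_pos)

lemma PV.defC_pos {n : ℕ} {p : ℕ → ℝ} (h : PV n p) : 0 < defC n p := by
  have := h.defC_ge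
  have := h.sq_pos
  linarith

lemma PV.offdiag {n : ℕ} {p : ℕ → ℝ} (h : PV n p) :
    ∑ x : Fin n, ∑ y : Fin n, (if x ≠ y then p x * p y else 0) = defC n p := by
  have h1 : ∀ x : Fin n, ∑ y : Fin n, (if x ≠ y then p x * p y else 0) = p x - p x ^ 2 := by
    intro x
    have : ∀ y : Fin n, (if x ≠ y then p x * p y else 0) = p x * p y - if x = y then p x * p y else 0 := by
      intro y
      split_ifs <;> simp_all
    simp_rw [this]
    rw [Finset.sum_sub_distrib, ← Finset.mul_sum, h.sumFin]
    simp [sq]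
  simp_rw [h1]
  rw [Finset.sum_sub_distrib, h.sumFin, defC, Finset.sum_range]

lemma PV.w_nonneg {n : ℕ} {p : ℕ → ℝ} (h : PV n p) (c) : 0 ≤ clauseProb2 n p c := by
  have hC : 0 < 1 - ∑ i ∈ Finset.range n, p i ^ 2 := h.defC_pos
  unfold clauseProb2
  split_ifs
  · have h1 := h.pos c.1.1 c.1.1.2
    have h2 := h.pos c.2.1 c.2.1.2
    positivity
  · exact le_rfl

lemma PV.w_sum_a {n : ℕ} {p : ℕ → ℝ} (h : PV n p) (a : Fin n → Bool) :
    ∑ c, (if a c.1.1 = c.1.2 ∨ a c.2.1 = c.2.2 then clauseProb2 n p c else 0) = 3 / 4 := by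
  have hC := h.defC_pos
  have key : ∑ c, (if a c.1.1 = c.1.2 ∨ a c.2.1 = c.2.2 then clauseProb2 n p c else 0)
      = ∑ x : Fin n, ∑ y : Fin n, (3 / 4 * (defC n p)⁻¹) * (if x ≠ y then p x * p y else 0) := by
    simp only [Fintype.sum_prod_type, clauseProb2, Fintype.sum_bool, ← Finset.sum_add_distrib]
    refine Finset.sum_congr rfl fun x _ => Finset.sum_congr rfl fun y _ => ?_
    cases a x <;> cases a y <;> by_cases hxy : x = y <;> simp [hxy, defC] <;> ring
  rw [key]
  simp_rw [← Finset.mul_sum]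
  rw [h.offdiag]
  field_simp

lemma PV.w_sum {n : ℕ} {p : ℕ → ℝ} (h : PV n p) : ∑ c, clauseProb2 n p c = 1 := by
  have hC := h.defC_pos
  have key : ∑ c, clauseProb2 n p c
      = ∑ x : Fin n, ∑ y : Fin n, ((defC n p)⁻¹) * (if x ≠ y then p x * p y else 0) := by
    simp only [Fintype.sum_prod_type, clauseProb2, Fintype.sum_bool, ← Finset.sum_add_distrib]
    refine Finset.sum_congr rfl fun x _ => Finset.sum_congr rfl fun y _ => ?_
    by_cases hxy : x = y <;> simp [hxy, defC]; ring
  rw [key]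
  simp_rw [← Finset.mul_sum]
  rw [h.offdiag]
  field_simp

/-- Expectation over `m` independent draws. -/
noncomputable def EE {α : Type*} [Fintype α] (w : α → ℝ) (m : ℕ) (F : (Fin m → α) → ℝ) : ℝ :=
  ∑ Φ : Fin m → α, (∏ j, w (Φ j)) * F Φ

lemma EE_mono {α : Type*} [Fintype α] {w : α → ℝ} (hw : ∀ c, 0 ≤ w c) {m : ℕ}
    {F G : (Fin m → α) → ℝ} (h : ∀ Φ, (∏ j, w (Φ j)) ≠ 0 → F Φ ≤ G Φ) : EE w m F ≤ EE w m G := by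
  unfold EE
  refine Finset.sum_le_sum fun Φ _ => ?_
  by_cases h0 : (∏ j, w (Φ j)) = 0
  · simp [h0]
  · exact mul_le_mul_of_nonneg_left (h Φ h0) (Finset.prod_nonneg fun _ _ => hw _)

lemma EE_sum {α ι : Type*} [Fintype α] {w : α → ℝ} {m : ℕ} (s : Finset ι)
    (F : ι → (Fin m → α) → ℝ) : EE w m (fun Φ => ∑ i ∈ s, F i Φ) = ∑ i ∈ s, EE w m (F i) := by
  unfold EE
  rw [Finset.sum_comm]
  simp_rw [Finset.mul_sum]

lemma EE_add {α : Type*} [Fintype α] {w : α → ℝ} {m : ℕ}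
    (F G : (Fin m → α) → ℝ) : EE w m (fun Φ => F Φ + G Φ) = EE w m F + EE w m G := by
  unfold EE
  rw [← Finset.sum_add_distrib]
  simp_rw [mul_add]

lemma EE_mul {α : Type*} [Fintype α] {w : α → ℝ} {m : ℕ} (a : ℝ)
    (F : (Fin m → α) → ℝ) : EE w m (fun Φ => a * F Φ) = a * EE w m F := by
  unfold EE
  rw [Finset.mul_sum]
  exact Finset.sum_congr rfl fun _ _ => by ring

lemma EE_prod {α : Type*} [Fintype α] {w : α → ℝ} {m : ℕ} (g : Fin m → α → ℝ) :
    EE w m (fun Φ => ∏ j, g j (Φ j)) = ∏ j, ∑ c, w c * g j c := by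
  unfold EE
  rw [Fintype.prod_sum]
  simp_rw [← Finset.prod_mul_distrib]

lemma EE_one {α : Type*} [Fintype α] {w : α → ℝ} (hw : ∑ c, w c = 1) (m : ℕ) :
    EE w m (fun _ => 1) = 1 := by
  have := EE_prod (w := w) (m := m) (fun _ _ => 1)
  simpa [hw] using this

lemma EE_inj {α ι : Type*} [Fintype α] [Fintype ι] {w : α → ℝ} (hw : ∑ c, w c = 1) {m : ℕ}
    (J : ι → Fin m) (hJ : Function.Injective J) (f : ι → α → ℝ) :
    EE w m (fun Φ => ∏ i, f i (Φ (J i))) = ∏ i, ∑ c, w c * f i c := by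
  have h1 : (fun Φ : Fin m → α => ∏ i, f i (Φ (J i)))
      = fun Φ => ∏ j, (fun j c => ∏ i, if J i = j then f i c else 1) j (Φ j) := by
    funext Φ
    simp only
    rw [Finset.prod_comm]
    refine Finset.prod_congr rfl fun i _ => ?_
    simp
  rw [h1]
  refine (EE_prod (w := w) (fun j c => ∏ i, if J i = j then f i c else 1)).trans ?_
  have h2 : ∀ j : Fin m, ∑ c, w c * (∏ i, if J i = j then f i c else 1)
      = ∏ i, if J i = j then (∑ c, w c * f i c) else 1 := by
    intro j
    by_cases hj : ∃ i, J i = j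
    · obtain ⟨i, rfl⟩ := hj
      simp [hJ.eq_iff]
    · push Not at hj
      simp [hj, hw]
  simp_rw [h2]
  rw [Finset.prod_comm]
  simp

lemma probSat_eq (n m : ℕ) (p : ℕ → ℝ) :
    probSat2 n m p = EE (clauseProb2 n p) m (fun Φ => if Sat2 Φ then 1 else 0) := by
  unfold probSat2 EE formulaProb2
  simp

lemma PV.sat_unsat {n : ℕ} {p : ℕ → ℝ} (h : PV n p) (m : ℕ) : probSat2 n m p =
    1 - EE (clauseProb2 n p) m (fun Φ => if Sat2 Φ then 0 else 1) := by
  rw [probSat_eq, eq_sub_iff_add_eq, ← EE_add]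
  refine Eq.trans ?_ (EE_one h.w_sum m)
  congr 1
  funext Φ
  split_ifs <;> simp

lemma PV.sat_nonneg {n : ℕ} {p : ℕ → ℝ} (h : PV n p) (m : ℕ) : 0 ≤ probSat2 n m p := by
  rw [probSat_eq]
  unfold EE
  refine Finset.sum_nonneg fun Φ _ => mul_nonneg (Finset.prod_nonneg fun _ _ => h.w_nonneg _) ?_
  dsimp only
  split_ifs <;> simp

lemma PV.sat_le_one {n : ℕ} {p : ℕ → ℝ} (h : PV n p) (m : ℕ) : probSat2 n m p ≤ 1 := by
  rw [probSat_eq]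
  refine le_trans (EE_mono (G := fun _ => 1) h.w_nonneg fun Φ _ => ?_) (EE_one h.w_sum m).le
  split_ifs <;> simp

lemma PV.sat_zero {n : ℕ} {p : ℕ → ℝ} (h : PV n p) : probSat2 n 0 p = 1 := by
  rw [probSat_eq]
  refine Eq.trans ?_ (EE_one h.w_sum 0)
  congr 1
  funext Φ
  rw [if_pos]
  exact ⟨fun _ => true, fun j => j.elim0⟩

lemma PV.sat_succ {n : ℕ} {p : ℕ → ℝ} (h : PV n p) (m : ℕ) :
    3 / 4 * probSat2 n m p ≤ probSat2 n (m + 1) p := by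
  rw [probSat_eq, probSat_eq]
  unfold EE
  rw [← (Fin.consEquiv (fun _ => (Fin n × Bool) × (Fin n × Bool))).sum_comp, Fintype.sum_prod_type,
    Finset.sum_comm, Finset.mul_sum]
  refine Finset.sum_le_sum fun Φ _ => ?_
  dsimp only
  have hP : 0 ≤ ∏ j, clauseProb2 n p (Φ j) := Finset.prod_nonneg fun _ _ => h.w_nonneg _
  by_cases hs : Sat2 Φ
  · obtain ⟨a, ha⟩ := hs
    have hs : Sat2 Φ := ⟨a, ha⟩
    rw [if_pos hs, ← h.w_sum_a a, mul_one, Finset.sum_mul]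
    refine Finset.sum_le_sum fun c _ => ?_
    simp only [Fin.consEquiv_apply, Fin.prod_univ_succ, Fin.cons_zero, Fin.cons_succ]
    by_cases hc : a c.1.1 = c.1.2 ∨ a c.2.1 = c.2.2
    · rw [if_pos hc, if_pos, mul_one]
      refine ⟨a, fun j => ?_⟩
      refine Fin.cases ?_ (fun j => ?_) j
      · simpa using hc
      · simpa using ha j
    · rw [if_neg hc, zero_mul]
      refine mul_nonneg (mul_nonneg (h.w_nonneg _) hP) ?_
      split_ifs <;> simp
  · rw [if_neg hs]
    simp only [mul_zero]
    refine Finset.sum_nonneg fun c _ => mul_nonneg (Finset.prod_nonneg fun _ _ => h.w_nonneg _) ?_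
    split_ifs <;> simp

def ng {n : ℕ} (l : Fin n × Bool) : Fin n × Bool := (l.1, !l.2)

lemma ng_ng {n : ℕ} (l : Fin n × Bool) : ng (ng l) = l := by simp [ng]

lemma ng_ne {n : ℕ} (l : Fin n × Bool) : ng l ≠ l := by
  intro h
  have := congrArg Prod.snd h
  simp [ng] at this

lemma lit_cases {n : ℕ} {l l' : Fin n × Bool} (h : l.1 = l'.1) : l = l' ∨ l = ng l' := by
  obtain ⟨x, b⟩ := l
  obtain ⟨y, c⟩ := l'
  simp only at h
  subst h
  cases b <;> cases c <;> simp [ng]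

/-- Implication edge. -/
def Edge {n m : ℕ} (Φ : Fin m → (Fin n × Bool) × (Fin n × Bool)) (a b : Fin n × Bool) : Prop :=
  ∃ j, Φ j = (ng a, b) ∨ Φ j = (b, ng a)

lemma Edge.contra {n m : ℕ} {Φ : Fin m → (Fin n × Bool) × (Fin n × Bool)} {a b : Fin n × Bool}
    (h : Edge Φ a b) : Edge Φ (ng b) (ng a) := by
  obtain ⟨j, h | h⟩ := h
  · exact ⟨j, Or.inr (by rw [ng_ng]; exact h)⟩
  · exact ⟨j, Or.inl (by rw [ng_ng]; exact h)⟩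

def Rch {n m : ℕ} (Φ : Fin m → (Fin n × Bool) × (Fin n × Bool)) :=
  Relation.ReflTransGen (Edge Φ)

lemma Rch.contra {n m : ℕ} {Φ : Fin m → (Fin n × Bool) × (Fin n × Bool)} {a b : Fin n × Bool}
    (h : Rch Φ a b) : Rch Φ (ng b) (ng a) := by
  induction h with
  | refl => exact Relation.ReflTransGen.refl
  | tail _ h2 ih => exact Relation.ReflTransGen.head h2.contra ih

lemma sat_of_no_rch {n m : ℕ} (Φ : Fin m → (Fin n × Bool) × (Fin n × Bool))
    (h : ∀ y, ¬ Rch Φ y (ng y)) : Sat2 Φ := by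
  let T : Set (Set (Fin n × Bool)) :=
    {A | (∀ l ∈ A, ng l ∉ A) ∧ ∀ l ∈ A, ∀ l', Edge Φ l l' → l' ∈ A}
  obtain ⟨A, ⟨hA1, hA2⟩, hmax⟩ := (Set.toFinite T).exists_maximal ⟨∅, by simp [T]⟩
  have hA3 : ∀ l ∈ A, ∀ l', Rch Φ l l' → l' ∈ A := by
    intro l hl l' hr
    induction hr with
    | refl => exact hl
    | tail _ h2 ih => exact hA2 _ ih _ h2
  have hfull : ∀ x : Fin n × Bool, x ∈ A ∨ ng x ∈ A := by
    intro x
    by_contra hx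
    push Not at hx
    have hB : A ∪ {l | Rch Φ x l} ∈ T := by
      refine ⟨?_, ?_⟩
      · rintro l (hl | hl) (hl' | hl')
        · exact hA1 l hl hl'
        · have := Rch.contra hl'
          rw [ng_ng] at this
          exact hx.2 (hA3 l hl _ this)
        · exact hx.2 (hA3 _ hl' _ (Rch.contra hl))
        · have := Rch.contra hl'
          rw [ng_ng] at this
          exact h x (Relation.ReflTransGen.trans hl this)
      · rintro l (hl | hl) l' he
        · exact Or.inl (hA2 l hl l' he)
        · exact Or.inr (Relation.ReflTransGen.tail hl he)
    have := hmax hB Set.subset_union_left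
    exact hx.1 (this (Or.inr Relation.ReflTransGen.refl))
  refine ⟨fun x => decide ((x, true) ∈ A), fun j => ?_⟩
  have hval : ∀ l : Fin n × Bool, l ∈ A → decide ((l.1, true) ∈ A) = l.2 := by
    rintro ⟨x, b⟩ hl
    cases b
    · have := hA1 _ hl
      simpa [ng] using this
    · simpa using hl
  rcases hfull (Φ j).1 with h1 | h1
  · exact Or.inl (hval _ h1)
  · exact Or.inr (hval _ (hA2 _ h1 _ ⟨j, Or.inl (by rw [ng_ng])⟩))

def IsWalk {n m : ℕ} (Φ : Fin m → (Fin n × Bool) × (Fin n × Bool)) (L : ℕ)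
    (f : ℕ → Fin n × Bool) : Prop := ∀ i < L, Edge Φ (f i) (f (i + 1))

lemma walk_of_rch {n m : ℕ} {Φ : Fin m → (Fin n × Bool) × (Fin n × Bool)} {a b : Fin n × Bool}
    (h : Rch Φ a b) : ∃ L f, IsWalk Φ L f ∧ f 0 = a ∧ f L = b := by
  induction h with
  | refl => exact ⟨0, fun _ => a, fun i hi => by omega, rfl, rfl⟩
  | @tail b c _ h2 ih =>
    obtain ⟨L, f, hf, h0, hL⟩ := ih
    refine ⟨L + 1, fun t => if t ≤ L then f t else c, fun i hi => ?_, by simp [h0], by simp⟩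
    by_cases h : i < L
    · have h' : i + 1 ≤ L := h
      simp only [h.le, h', if_true]
      exact hf i h
    · have : i = L := by omega
      subst this
      simp only [le_refl, if_true]
      rw [if_neg (by omega), hL]
      exact h2

lemma min_walk {n m : ℕ} {Φ : Fin m → (Fin n × Bool) × (Fin n × Bool)} (h : ¬ Sat2 Φ) :
    ∃ L f, IsWalk Φ L f ∧ f L = ng (f 0) ∧ 1 ≤ L ∧
      ∀ i j, i < j → j < L → (f i).1 ≠ (f j).1 := by
  have h1 : ∃ y, Rch Φ y (ng y) := by
    by_contra hc
    push Not at hc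
    exact h (sat_of_no_rch Φ hc)
  obtain ⟨y, hy⟩ := h1
  have h2 : ∃ L, ∃ f, IsWalk Φ L f ∧ f L = ng (f 0) := by
    obtain ⟨L, f, hf, h0, hL⟩ := walk_of_rch hy
    exact ⟨L, f, hf, by rw [h0, hL]⟩
  obtain ⟨f, hf, hL⟩ := Nat.find_spec h2
  have hmin : ∀ L' < Nat.find h2, ¬ ∃ f, IsWalk Φ L' f ∧ f L' = ng (f 0) :=
    fun L' hL' => Nat.find_min h2 hL'
  generalize Nat.find h2 = L at hf hL hmin
  refine ⟨L, f, hf, hL, ?_, ?_⟩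
  · by_contra hc
    have : L = 0 := by omega
    subst this
    exact ng_ne _ hL.symm
  · intro i j hij hj he
    rcases lit_cases he with he | he
    · refine hmin (L - (j - i)) (by omega)
        ⟨fun t => if t ≤ i then f t else f (t + (j - i)), fun t ht => ?_, ?_⟩
      · rcases lt_trichotomy t i with h | h | h
        · simp only [h.le, if_true, if_pos (show t + 1 ≤ i from h)]
          exact hf t (by omega)
        · subst h
          simp only [le_refl, if_true, if_neg (show ¬ (t + 1 ≤ t) by omega)]
          rw [he, show t + 1 + (j - t) = j + 1 by omega]
          exact hf j hj
        · simp only [if_neg (show ¬ (t ≤ i) by omega), if_neg (show ¬ (t + 1 ≤ i) by omega)]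
          rw [show t + 1 + (j - i) = t + (j - i) + 1 by omega]
          exact hf _ (by omega)
      · simp only [if_neg (show ¬ (L - (j - i) ≤ i) by omega), zero_le, if_true]
        rw [show L - (j - i) + (j - i) = L by omega]
        exact hL
    · refine hmin (j - i) (by omega) ⟨fun t => f (i + t), fun t ht => ?_, ?_⟩
      · exact hf (i + t) (by omega)
      · simp only [add_zero, show i + (j - i) = j by omega]
        rw [he, ng_ng]

def nx {n k : ℕ} (l : Fin (k + 2) → Fin n × Bool) (i : Fin (k + 2)) : Fin n × Bool :=
  if i = Fin.last (k + 1) then ng (l 0) else l (i + 1)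

lemma nx_fst {n k : ℕ} (l : Fin (k + 2) → Fin n × Bool) (i : Fin (k + 2)) :
    (nx l i).1 = (l (i + 1)).1 := by
  unfold nx
  split_ifs with h
  · subst h
    simp [ng]
  · rfl

lemma exists_chain {n m : ℕ} {Φ : Fin m → (Fin n × Bool) × (Fin n × Bool)} (h : ¬ Sat2 Φ)
    (hprop : ∀ j, (Φ j).1.1 ≠ (Φ j).2.1) :
    ∃ k, k + 2 ≤ n ∧ ∃ l : Fin (k + 2) → Fin n × Bool, (Function.Injective fun i => (l i).1) ∧
      ∃ J : Fin (k + 2) → Fin m, Function.Injective J ∧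
        ∀ i, Φ (J i) = (ng (l i), nx l i) ∨ Φ (J i) = (nx l i, ng (l i)) := by
  obtain ⟨L, f, hf, hL, h1, hinj⟩ := min_walk h
  have hL2 : L ≠ 1 := by
    rintro rfl
    obtain ⟨j, hj⟩ := hf 0 (by omega)
    have := hprop j
    simp only [zero_add] at hj
    rw [hL] at hj
    rcases hj with hj | hj <;> rw [hj] at this <;> exact this rfl
  obtain ⟨k, rfl⟩ : ∃ k, L = k + 2 := ⟨L - 2, by omega⟩
  have hlinj : Function.Injective fun i : Fin (k + 2) => (f i).1 := by
    intro i j hij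
    rcases lt_trichotomy i j with h | h | h
    · exact absurd hij (hinj i j h j.2)
    · exact h
    · exact absurd hij.symm (hinj j i h i.2)
  have hnx : ∀ i : Fin (k + 2), f (i + 1 : ℕ) = nx (fun i : Fin (k + 2) => f i) i := by
    intro i
    unfold nx
    split_ifs with h
    · subst h
      simpa using hL
    · have : ((i + 1 : Fin (k + 2)) : ℕ) = i + 1 := by
        rw [Fin.val_add_one, if_neg h]
      dsimp only
      rw [this]
  have hE : ∀ i : Fin (k + 2), ∃ j, Φ j = (ng (f i), nx (fun i : Fin (k + 2) => f i) i) ∨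
      Φ j = (nx (fun i : Fin (k + 2) => f i) i, ng (f i)) := by
    intro i
    rw [← hnx]
    exact hf i i.2
  choose J hJ using hE
  refine ⟨k, ?_, fun i => f i, hlinj, J, ?_, hJ⟩
  · simpa using Fintype.card_le_of_injective _ hlinj
  · have hngi : ∀ i j : Fin (k + 2), ng (f i) = ng (f j) → i = j := by
      intro i j hij
      exact hlinj (congrArg Prod.fst hij : (ng (f i)).1 = (ng (f j)).1)
    have hcross : ∀ i j : Fin (k + 2), ng (f i) = nx (fun i : Fin (k + 2) => f i) j →
        nx (fun i : Fin (k + 2) => f i) i = ng (f j) → i = j := by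
      intro i j h1 h2
      by_contra hne
      wlog hlt : i < j generalizing i j
      · exact this j i h2.symm h1.symm (Ne.symm hne) (by omega)
      have hil : i ≠ Fin.last (k + 1) := fun h => by
        subst h
        exact absurd hlt (not_lt.2 (Fin.le_last j))
      have e2 : i + 1 = j := by
        apply hlinj
        have := congrArg Prod.fst h2
        rw [nx_fst] at this
        exact this
      unfold nx at h2
      rw [if_neg hil] at h2
      simp only [e2] at h2
      exact ng_ne _ h2.symm
    intro i j hij
    have hi := hJ i
    have hj := hJ j
    rw [hij] at hi
    rcases hi with hi | hi <;> rcases hj with hj | hj <;> rw [hi] at hj <;>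
      simp only [Prod.mk.injEq] at hj
    · exact hngi _ _ hj.1
    · exact hcross i j hj.1 hj.2
    · exact hcross i j hj.2 hj.1
    · exact hngi _ _ hj.2

noncomputable def ind {n : ℕ} (a b : Fin n × Bool) (c : (Fin n × Bool) × (Fin n × Bool)) : ℝ :=
  if c = (ng a, b) ∨ c = (b, ng a) then 1 else 0

lemma ind_nonneg {n : ℕ} (a b : Fin n × Bool) (c) : 0 ≤ ind a b c := by
  unfold ind
  split_ifs <;> simp

lemma PV.w_le {n : ℕ} {p : ℕ → ℝ} (h : PV n p) (c) :
    clauseProb2 n p c ≤ (defC n p)⁻¹ / 4 * p c.1.1 * p c.2.1 := by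
  have hC := h.defC_pos
  have h1 := h.pos c.1.1 c.1.1.2
  have h2 := h.pos c.2.1 c.2.1.2
  unfold clauseProb2
  split_ifs
  · exact le_rfl
  · positivity

lemma PV.ind_le {n : ℕ} {p : ℕ → ℝ} (h : PV n p) (a b : Fin n × Bool) :
    ∑ c, clauseProb2 n p c * ind a b c ≤ (defC n p)⁻¹ / 2 * (p a.1 * p b.1) := by
  calc ∑ c, clauseProb2 n p c * ind a b c
      ≤ ∑ c, ((if c = (ng a, b) then clauseProb2 n p c else 0) +
          (if c = (b, ng a) then clauseProb2 n p c else 0)) := by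
        refine Finset.sum_le_sum fun c _ => ?_
        have := h.w_nonneg c
        unfold ind
        by_cases h1 : c = (ng a, b) <;> by_cases h2 : c = (b, ng a) <;>
          simp only [h1, h2, if_true, if_false, or_true, true_or, or_self, mul_one, mul_zero,
            add_zero, le_refl]
        all_goals
          split_ifs <;> simp [h.w_nonneg]
    _ = clauseProb2 n p (ng a, b) + clauseProb2 n p (b, ng a) := by
        rw [Finset.sum_add_distrib]
        simp
    _ ≤ _ := by
        have h1 := h.w_le (ng a, b)
        have h2 := h.w_le (b, ng a)
        simp only [ng] at h1 h2 ⊢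
        linarith

lemma inj_sum {Λ β : Type*} [Fintype Λ] [DecidableEq β] (g : Λ → ℝ) (hg : ∀ x, 0 ≤ g x) (h : Λ → β) (z : β)
    (K : ℕ) :
    ∑ l : Fin K → Λ, (if Function.Injective (fun i => h (l i)) then ∏ i, g (l i) else 0) ≤
      (∑ x, if h x ≠ z then g x else 0) ^ K +
        K * ((∑ x, if h x = z then g x else 0) * (∑ x, if h x ≠ z then g x else 0) ^ (K - 1)) := by
  have hpt : ∀ l : Fin K → Λ,
      (if Function.Injective (fun i => h (l i)) then ∏ i, g (l i) else 0) ≤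
      ∏ i, (if h (l i) ≠ z then g (l i) else 0) +
        ∑ i, ∏ j, (if j = i then (if h (l j) = z then g (l j) else 0)
          else (if h (l j) ≠ z then g (l j) else 0)) := by
    intro l
    have hn1 : 0 ≤ ∏ i, (if h (l i) ≠ z then g (l i) else 0) :=
      Finset.prod_nonneg fun i _ => by split_ifs <;> simp [hg]
    have hn2 : ∀ i ∈ (Finset.univ : Finset (Fin K)), 0 ≤ ∏ j, (if j = i then (if h (l j) = z then g (l j) else 0)
          else (if h (l j) ≠ z then g (l j) else 0)) := fun i _ =>
      Finset.prod_nonneg fun j _ => by split_ifs <;> simp [hg]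
    split_ifs with hinj
    · by_cases hz : ∃ i, h (l i) = z
      · obtain ⟨i, hi⟩ := hz
        refine le_add_of_nonneg_of_le hn1 (le_trans (le_of_eq ?_)
          (Finset.single_le_sum hn2 (Finset.mem_univ i)))
        refine Finset.prod_congr rfl fun j _ => ?_
        by_cases hj : j = i
        · subst hj; simp [hi]
        · have : h (l j) ≠ z := fun hc => hj (hinj (hc.trans hi.symm))
          simp [hj, this]
      · push Not at hz
        refine le_add_of_le_of_nonneg (le_of_eq ?_) (Finset.sum_nonneg hn2)
        exact Finset.prod_congr rfl fun j _ => by simp [hz j]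
    · exact add_nonneg hn1 (Finset.sum_nonneg hn2)
  refine (Finset.sum_le_sum fun l _ => hpt l).trans (le_of_eq ?_)
  rw [Finset.sum_add_distrib, Finset.sum_comm]
  congr 1
  · rw [← Fintype.prod_sum (fun (_ : Fin K) x => if h x ≠ z then g x else 0)]
    simp
  · have : ∀ i : Fin K, ∑ l : Fin K → Λ, ∏ j, (if j = i then (if h (l j) = z then g (l j) else 0)
          else (if h (l j) ≠ z then g (l j) else 0)) =
        (∑ x, if h x = z then g x else 0) * (∑ x, if h x ≠ z then g x else 0) ^ (K - 1) := by
      intro i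
      rw [← Fintype.prod_sum (fun (j : Fin K) x => if j = i then (if h x = z then g x else 0)
          else (if h x ≠ z then g x else 0)), Fintype.prod_eq_mul_prod_compl i]
      congr 1
      · simp
      · rw [Finset.prod_congr rfl (g := fun _ => ∑ x, if h x ≠ z then g x else 0)]
        · simp [Finset.card_compl]
        · intro j hj
          have : j ≠ i := by simpa using hj
          simp [this]
    rw [Finset.sum_congr rfl fun i _ => this i]
    simp

lemma PV.unsat_le {n : ℕ} {p : ℕ → ℝ} (h : PV n p) (m : ℕ) :
    EE (clauseProb2 n p) m (fun Φ => if Sat2 Φ then 0 else 1) ≤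
      ∑ k ∈ Finset.range n, ((m * (defC n p)⁻¹ * tailS n p) ^ (k + 2) +
        (k + 2 : ℕ) * ((m * (defC n p)⁻¹ * p 0 ^ 2) * (m * (defC n p)⁻¹ * tailS n p) ^ (k + 1))) := by
  have hC := h.defC_pos
  have step1 : EE (clauseProb2 n p) m (fun Φ => if Sat2 Φ then 0 else 1) ≤
      EE (clauseProb2 n p) m (fun Φ => ∑ k ∈ Finset.range n,
        ∑ l ∈ Finset.univ.filter (fun l : Fin (k + 2) → Fin n × Bool =>
            Function.Injective fun i => (l i).1),
          ∑ J ∈ Finset.univ.filter (fun J : Fin (k + 2) → Fin m => Function.Injective J),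
            ∏ i, ind (l i) (nx l i) (Φ (J i))) := by
    refine EE_mono h.w_nonneg fun Φ hΦ => ?_
    have hn0 : ∀ (k : ℕ) (l : Fin (k + 2) → Fin n × Bool) (J : Fin (k + 2) → Fin m),
        0 ≤ ∏ i, ind (l i) (nx l i) (Φ (J i)) := fun k l J =>
      Finset.prod_nonneg fun i _ => ind_nonneg _ _ _
    have hn1 : ∀ (k : ℕ) (l : Fin (k + 2) → Fin n × Bool), 0 ≤
        ∑ J ∈ Finset.univ.filter (fun J : Fin (k + 2) → Fin m => Function.Injective J),
            ∏ i, ind (l i) (nx l i) (Φ (J i)) := fun k l => Finset.sum_nonneg fun J _ => hn0 k l J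
    have hn2 : ∀ (k : ℕ), 0 ≤ ∑ l ∈ Finset.univ.filter (fun l : Fin (k + 2) → Fin n × Bool =>
            Function.Injective fun i => (l i).1),
        ∑ J ∈ Finset.univ.filter (fun J : Fin (k + 2) → Fin m => Function.Injective J),
            ∏ i, ind (l i) (nx l i) (Φ (J i)) := fun k => Finset.sum_nonneg fun l _ => hn1 k l
    split_ifs with hs
    · exact Finset.sum_nonneg fun k _ => hn2 k
    · have hprop : ∀ j, (Φ j).1.1 ≠ (Φ j).2.1 := by
        intro j hj
        apply hΦ
        apply Finset.prod_eq_zero (Finset.mem_univ j)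
        simp [clauseProb2, hj]
      obtain ⟨k, hk, l, hl, J, hJ, hch⟩ := exists_chain hs hprop
      refine le_trans ?_ (Finset.single_le_sum (fun k _ => hn2 k)
        (Finset.mem_range.2 (show k < n by omega)))
      refine le_trans ?_ (Finset.single_le_sum (fun l _ => hn1 k l)
        (Finset.mem_filter.2 ⟨Finset.mem_univ l, hl⟩))
      refine le_trans ?_ (Finset.single_le_sum (fun J _ => hn0 k l J)
        (Finset.mem_filter.2 ⟨Finset.mem_univ J, hJ⟩))
      rw [Finset.prod_eq_one]
      intro i _
      unfold ind
      rw [if_pos (hch i)]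
  refine step1.trans ?_
  rw [EE_sum]
  refine Finset.sum_le_sum fun k _ => ?_
  rw [EE_sum]
  have step2 : ∀ l : Fin (k + 2) → Fin n × Bool,
      EE (clauseProb2 n p) m (fun Φ =>
        ∑ J ∈ Finset.univ.filter (fun J : Fin (k + 2) → Fin m => Function.Injective J),
            ∏ i, ind (l i) (nx l i) (Φ (J i))) ≤
        ∏ i, (m * ((defC n p)⁻¹ / 2 * p (l i).1 ^ 2)) := by
    intro l
    have hpp : ∀ x : Fin n, 0 < p x := fun x => h.pos x x.2
    rw [EE_sum]
    have e1 : ∀ J ∈ Finset.univ.filter (fun J : Fin (k + 2) → Fin m => Function.Injective J),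
        EE (clauseProb2 n p) m (fun Φ => ∏ i, ind (l i) (nx l i) (Φ (J i))) ≤
          ∏ i, ((defC n p)⁻¹ / 2 * p (l i).1 ^ 2) := by
      intro J hJ
      rw [EE_inj h.w_sum J (Finset.mem_filter.1 hJ).2 (fun i => ind (l i) (nx l i))]
      calc _ ≤ ∏ i, ((defC n p)⁻¹ / 2 * (p (l i).1 * p (l (i + 1)).1)) := by
            refine Finset.prod_le_prod (fun i _ => Finset.sum_nonneg fun c _ =>
              mul_nonneg (h.w_nonneg c) (ind_nonneg _ _ _)) fun i _ => ?_
            have := h.ind_le (l i) (nx l i)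
            rwa [nx_fst] at this
        _ = _ := by
            simp only [Finset.prod_mul_distrib, sq]
            congr 2
            exact Equiv.prod_comp (Equiv.addRight (1 : Fin (k + 2))) (fun i => p (l i).1)
    refine (Finset.sum_le_card_nsmul _ _ _ e1).trans ?_
    rw [nsmul_eq_mul, Finset.prod_mul_distrib (f := fun _ => (m : ℝ))
      (g := fun i => (defC n p)⁻¹ / 2 * p (l i).1 ^ 2)]
    refine mul_le_mul_of_nonneg_right ?_ (Finset.prod_nonneg fun i _ => by
      have := hpp (l i).1
      positivity)
    simp only [Finset.prod_const, Finset.card_univ, Fintype.card_fin]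
    have : (Finset.univ.filter (fun J : Fin (k + 2) → Fin m => Function.Injective J)).card
        ≤ m ^ (k + 2) := by
      refine (Finset.card_filter_le _ _).trans ?_
      simp
    exact_mod_cast this
  refine (Finset.sum_le_sum fun l _ => step2 l).trans ?_
  rw [Finset.sum_filter]
  have h0n : 0 < n := by have := h.two; omega
  have := inj_sum (fun l : Fin n × Bool => m * ((defC n p)⁻¹ / 2 * p l.1 ^ 2))
    (fun x => by have := h.pos x.1 x.1.2; positivity) (fun l => l.1) ⟨0, h0n⟩ (k + 2)
  refine this.trans (le_of_eq ?_)
  have eD : ∑ x : Fin n × Bool, (if x.1 = ⟨0, h0n⟩ then m * ((defC n p)⁻¹ / 2 * p x.1 ^ 2) else 0)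
      = m * (defC n p)⁻¹ * p 0 ^ 2 := by
    rw [Fintype.sum_prod_type]
    simp
    ring
  have eT : ∑ x : Fin n × Bool, (m * ((defC n p)⁻¹ / 2 * p x.1 ^ 2))
      = m * (defC n p)⁻¹ * (p 0 ^ 2 + tailS n p) := by
    rw [Fintype.sum_prod_type, ← h.split, Finset.sum_range, Finset.mul_sum]
    simp
    exact Finset.sum_congr rfl fun i _ => by ring
  have eB : ∑ x : Fin n × Bool, (if x.1 ≠ ⟨0, h0n⟩ then m * ((defC n p)⁻¹ / 2 * p x.1 ^ 2) else 0)
      = m * (defC n p)⁻¹ * tailS n p := by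
    have : ∑ x : Fin n × Bool, (if x.1 ≠ ⟨0, h0n⟩ then m * ((defC n p)⁻¹ / 2 * p x.1 ^ 2) else 0)
      + ∑ x : Fin n × Bool, (if x.1 = ⟨0, h0n⟩ then m * ((defC n p)⁻¹ / 2 * p x.1 ^ 2) else 0)
      = ∑ x : Fin n × Bool, (m * ((defC n p)⁻¹ / 2 * p x.1 ^ 2)) := by
      rw [← Finset.sum_add_distrib]
      refine Finset.sum_congr rfl fun x _ => ?_
      by_cases hx : x.1 = ⟨0, h0n⟩ <;> simp [hx]
    rw [eT, eD] at this
    linarith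
  rw [eD, eB]
  rfl

lemma PV.sat_lower {n : ℕ} {p : ℕ → ℝ} (h : PV n p) (m : ℕ) (D a : ℝ) (hD : 1 ≤ D)
    (hT : Real.sqrt (tailS n p) ≤ D * p 0)
    (ha : (m : ℝ) * (p 0 * Real.sqrt (tailS n p)) ≤ a * defC n p) (hDa : D * a ≤ 1 / 4) :
    1 - 6 * (D * a) ^ 2 ≤ probSat2 n m p := by
  have hC := h.defC_pos
  have h0 := h.p0_pos
  have hTp := h.tail_pos
  have hsq := Real.sq_sqrt hTp.le
  have hs0 := Real.sqrt_pos.2 hTp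
  have hm : (0 : ℝ) ≤ m := Nat.cast_nonneg m
  set s := Real.sqrt (tailS n p) with hs
  set b := (m : ℝ) * (defC n p)⁻¹ * tailS n p with hb
  set d := (m : ℝ) * (defC n p)⁻¹ * p 0 ^ 2 with hd
  have hb0 : 0 ≤ b := by positivity
  have hd0 : 0 ≤ d := by positivity
  have ha' : m * (defC n p)⁻¹ * (p 0 * s) ≤ a := by
    rw [← div_eq_mul_inv, div_mul_eq_mul_div, div_le_iff₀ hC]
    exact ha
  have ha0 : 0 ≤ a := le_trans (by positivity) ha'
  have hdb : d * b ≤ a ^ 2 := by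
    have : d * b = (m * (defC n p)⁻¹ * (p 0 * s)) ^ 2 := by
      rw [hd, hb, ← hsq]; ring
    rw [this]
    exact pow_le_pow_left₀ (by positivity) ha' 2
  have hbD : b ≤ D * a := by
    have : b = m * (defC n p)⁻¹ * s * s := by rw [hb, ← hsq]; ring
    calc b = m * (defC n p)⁻¹ * s * s := this
      _ ≤ m * (defC n p)⁻¹ * s * (D * p 0) := by gcongr
      _ = D * (m * (defC n p)⁻¹ * (p 0 * s)) := by ring
      _ ≤ D * a := by gcongr
  rw [h.sat_unsat]
  have hle := h.unsat_le m
  rw [← hb, ← hd] at hle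
  have haD : a ^ 2 ≤ (D * a) ^ 2 := pow_le_pow_left₀ ha0 (by nlinarith) 2
  have hterm : ∀ k ∈ Finset.range n, b ^ (k + 2) + (k + 2 : ℕ) * (d * b ^ (k + 1)) ≤
      3 * (D * a) ^ 2 * (1 / 2) ^ k := by
    intro k _
    have hk : ((k + 2 : ℕ) : ℝ) ≤ 2 * 2 ^ k := by
      have : k + 2 ≤ 2 * 2 ^ k := by
        have := Nat.lt_two_pow_self (n := k + 1)
        rw [pow_succ] at this
        omega
      exact_mod_cast this
    have hbk : b ^ k ≤ (1 / 4) ^ k := pow_le_pow_left₀ hb0 (by linarith) k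
    have hb2 : b ^ 2 ≤ (D * a) ^ 2 := pow_le_pow_left₀ hb0 hbD 2
    have h4 : ((1 : ℝ) / 4) ^ k ≤ (1 / 2) ^ k := pow_le_pow_left₀ (by norm_num) (by norm_num) k
    have h24 : (2 : ℝ) ^ k * (1 / 4) ^ k = (1 / 2) ^ k := by rw [← mul_pow]; norm_num
    have t1 : b ^ (k + 2) ≤ (D * a) ^ 2 * (1 / 2) ^ k := by
      rw [pow_add, mul_comm]
      exact mul_le_mul hb2 (hbk.trans h4) (by positivity) (by positivity)
    have t2 : (k + 2 : ℕ) * (d * b ^ (k + 1)) ≤ 2 * ((D * a) ^ 2 * (1 / 2) ^ k) := by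
      calc ((k + 2 : ℕ) : ℝ) * (d * b ^ (k + 1)) = (d * b) * ((k + 2 : ℕ) * b ^ k) := by ring
        _ ≤ (D * a) ^ 2 * ((2 * 2 ^ k) * (1 / 4) ^ k) := by
            gcongr
            exact hdb.trans haD
        _ = 2 * ((D * a) ^ 2 * (1 / 2) ^ k) := by rw [← h24]; ring
    linarith
  have hsum := hle.trans (Finset.sum_le_sum hterm)
  rw [← Finset.mul_sum] at hsum
  have hg : ∑ k ∈ Finset.range n, ((1 : ℝ) / 2) ^ k ≤ 2 := by
    have := sum_geometric_two_le n
    simpa using this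
  have : 3 * (D * a) ^ 2 * ∑ k ∈ Finset.range n, ((1 : ℝ) / 2) ^ k ≤ 3 * (D * a) ^ 2 * 2 := by gcongr
  linarith

lemma EE_at {α : Type*} [Fintype α] {w : α → ℝ} (hw : ∑ c, w c = 1) {m : ℕ} (j : Fin m)
    (f : α → ℝ) : EE w m (fun Φ => f (Φ j)) = ∑ c, w c * f c := by
  have := EE_inj hw (fun _ : Unit => j) (fun _ _ _ => rfl) (fun _ => f)
  simpa using this

lemma EE_at2 {α : Type*} [Fintype α] {w : α → ℝ} (hw : ∑ c, w c = 1) {m : ℕ} {j j' : Fin m}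
    (hj : j ≠ j') (f g : α → ℝ) :
    EE w m (fun Φ => f (Φ j) * g (Φ j')) = (∑ c, w c * f c) * ∑ c, w c * g c := by
  have := EE_inj hw (fun b : Bool => if b then j else j')
    (by intro a b; cases a <;> cases b <;> simp [hj, hj.symm]) (fun b => if b then f else g)
  simpa using this

lemma EE_mom1 {α : Type*} [Fintype α] {w : α → ℝ} (hw : ∑ c, w c = 1) (m : ℕ)
    (f : α → ℝ) : EE w m (fun Φ => ∑ j, f (Φ j)) = m * ∑ c, w c * f c := by
  rw [EE_sum]
  simp_rw [EE_at hw]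
  simp

lemma EE_mom2 {α : Type*} [Fintype α] {w : α → ℝ} (hw : ∑ c, w c = 1) (hw0 : ∀ c, 0 ≤ w c) (m : ℕ)
    (f g : α → ℝ) (hf : ∀ c, 0 ≤ f c) (hg : ∀ c, 0 ≤ g c) :
    EE w m (fun Φ => (∑ j, f (Φ j)) * ∑ j, g (Φ j)) ≤
      m * (∑ c, w c * (f c * g c)) + m ^ 2 * ((∑ c, w c * f c) * ∑ c, w c * g c) := by
  have h0 : (fun Φ : Fin m → α => (∑ j, f (Φ j)) * ∑ j, g (Φ j)) =
      fun Φ => ∑ j, ∑ j', f (Φ j) * g (Φ j') := by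
    funext Φ
    rw [Finset.sum_mul_sum]
  rw [h0, EE_sum]
  simp_rw [EE_sum]
  have hF : 0 ≤ ∑ c, w c * f c := Finset.sum_nonneg fun c _ => mul_nonneg (hw0 c) (hf c)
  have hG : 0 ≤ ∑ c, w c * g c := Finset.sum_nonneg fun c _ => mul_nonneg (hw0 c) (hg c)
  have : ∀ j j' : Fin m, EE w m (fun Φ => f (Φ j) * g (Φ j')) ≤
      (if j = j' then ∑ c, w c * (f c * g c) else 0) + (∑ c, w c * f c) * ∑ c, w c * g c := by
    intro j j'
    by_cases h : j = j'
    · subst h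
      rw [EE_at hw j (fun c => f c * g c), if_pos rfl]
      exact le_add_of_nonneg_right (mul_nonneg hF hG)
    · rw [EE_at2 hw h, if_neg h, zero_add]
  refine (Finset.sum_le_sum fun j _ => Finset.sum_le_sum fun j' _ => this j j').trans (le_of_eq ?_)
  simp only [Finset.sum_add_distrib]
  simp
  ring

lemma EE_append {α : Type*} [Fintype α] {w : α → ℝ} (a b : ℕ) (F : (Fin (a + b) → α) → ℝ) :
    EE w (a + b) F = EE w a (fun Φ => EE w b (fun Ψ => F (Fin.append Φ Ψ))) := by
  unfold EE
  rw [← (Fin.appendEquiv a b).sum_comp, Fintype.sum_prod_type]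
  refine Finset.sum_congr rfl fun Φ _ => ?_
  rw [Finset.mul_sum]
  refine Finset.sum_congr rfl fun Ψ _ => ?_
  simp [Fin.appendEquiv, Fin.prod_univ_add]
  ring

lemma EE_pair {α : Type*} [Fintype α] {w : α → ℝ} (a b : ℕ) (A : (Fin a → α) → ℝ)
    (B : (Fin b → α) → ℝ) :
    EE w a (fun Φ => EE w b (fun Ψ => A Φ * B Ψ)) = EE w a A * EE w b B := by
  simp_rw [EE_mul]
  simp_rw [mul_comm _ (EE w b B)]
  rw [EE_mul]

lemma cheb {α ι : Type*} [Fintype α] [DecidableEq ι] {w : α → ℝ} (hw : ∑ c, w c = 1) (hw0 : ∀ c, 0 ≤ w c)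
    (a b : ℕ) (I : Finset ι) (f g : ι → α → ℝ) (r : ι → ℝ)
    (hf : ∀ i c, 0 ≤ f i c) (hg : ∀ i c, 0 ≤ g i c)
    (hfr : ∀ i ∈ I, ∑ c, w c * f i c = r i) (hgr : ∀ i ∈ I, ∑ c, w c * g i c = r i)
    (hff : ∀ i i' c, f i c * f i' c = if i = i' then f i c else 0)
    (hgg : ∀ i i' c, g i c * g i' c = if i = i' then g i c else 0) :
    EE w a (fun Φ => EE w b (fun Ψ =>
      if (∑ i ∈ I, (∑ j, f i (Φ j)) * ∑ j, g i (Ψ j)) = 0 then 1 else 0)) *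
      (a * b * ∑ i ∈ I, r i ^ 2) ^ 2 ≤
      a * b * (∑ i ∈ I, r i ^ 2) + (a * b ^ 2 + a ^ 2 * b) * ∑ i ∈ I, r i ^ 3 := by
  set μ := a * b * ∑ i ∈ I, r i ^ 2 with hμ
  have hr : ∀ i ∈ I, 0 ≤ r i := fun i hi => by
    rw [← hfr i hi]; exact Finset.sum_nonneg fun c _ => mul_nonneg (hw0 c) (hf i c)
  have hmu1 : EE w a (fun Φ => EE w b (fun Ψ =>
      ∑ i ∈ I, (∑ j, f i (Φ j)) * ∑ j, g i (Ψ j))) = μ := by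
    simp_rw [EE_sum I]
    rw [hμ, Finset.mul_sum]
    refine Finset.sum_congr rfl fun i hi => ?_
    rw [EE_pair a b (fun Φ => ∑ j, f i (Φ j)) (fun Ψ => ∑ j, g i (Ψ j)), EE_mom1 hw, EE_mom1 hw,
      hfr i hi, hgr i hi]
    ring
  have hmu2 : EE w a (fun Φ => EE w b (fun Ψ =>
      (∑ i ∈ I, (∑ j, f i (Φ j)) * ∑ j, g i (Ψ j)) ^ 2)) ≤
      a * b * (∑ i ∈ I, r i ^ 2) + (a * b ^ 2 + a ^ 2 * b) * (∑ i ∈ I, r i ^ 3) + μ ^ 2 := by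
    have e1 : EE w a (fun Φ => EE w b (fun Ψ =>
      (∑ i ∈ I, (∑ j, f i (Φ j)) * ∑ j, g i (Ψ j)) ^ 2)) = ∑ i ∈ I, ∑ i' ∈ I,
        EE w a (fun Φ => (∑ j, f i (Φ j)) * ∑ j, f i' (Φ j)) *
          EE w b (fun Ψ => (∑ j, g i (Ψ j)) * ∑ j, g i' (Ψ j)) := by
      have h0 : (fun Φ : Fin a → α => EE w b (fun Ψ =>
          (∑ i ∈ I, (∑ j, f i (Φ j)) * ∑ j, g i (Ψ j)) ^ 2)) =
          fun Φ => EE w b (fun Ψ => ∑ i ∈ I, ∑ i' ∈ I, ((∑ j, f i (Φ j)) * ∑ j, g i (Ψ j)) *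
            ((∑ j, f i' (Φ j)) * ∑ j, g i' (Ψ j))) := by
        funext Φ
        congr 1
        funext Ψ
        rw [sq, Finset.sum_mul_sum]
      rw [h0]
      simp_rw [EE_sum I]
      refine Finset.sum_congr rfl fun i hi => Finset.sum_congr rfl fun i' hi' => ?_
      rw [← EE_pair]
      congr 1
      funext Φ
      congr 1
      funext Ψ
      exact mul_mul_mul_comm _ _ _ _
    have e2 : ∀ i ∈ I, ∀ i' ∈ I,
        EE w a (fun Φ => (∑ j, f i (Φ j)) * ∑ j, f i' (Φ j)) *
          EE w b (fun Ψ => (∑ j, g i (Ψ j)) * ∑ j, g i' (Ψ j)) ≤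
        (if i = i' then a * b * r i ^ 2 + (a * b ^ 2 + a ^ 2 * b) * r i ^ 3 else 0) +
          a ^ 2 * b ^ 2 * (r i ^ 2 * r i' ^ 2) := by
      intro i hi i' hi'
      have f1 := EE_mom2 hw hw0 a (f i) (f i') (hf i) (hf i')
      have g1 := EE_mom2 hw hw0 b (g i) (g i') (hg i) (hg i')
      have hri := hr i hi
      have hri' := hr i' hi'
      rw [hfr i hi, hfr i' hi'] at f1
      rw [hgr i hi, hgr i' hi'] at g1
      simp_rw [hff] at f1
      simp_rw [hgg] at g1
      have g0 : 0 ≤ EE w b (fun Ψ => (∑ j, g i (Ψ j)) * ∑ j, g i' (Ψ j)) :=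
        Finset.sum_nonneg fun Ψ _ => mul_nonneg (Finset.prod_nonneg fun _ _ => hw0 _)
          (mul_nonneg (Finset.sum_nonneg fun _ _ => hg _ _) (Finset.sum_nonneg fun _ _ => hg _ _))
      by_cases h : i = i'
      · subst h
        simp only [if_true] at f1 g1 ⊢
        rw [hfr i hi] at f1
        rw [hgr i hi] at g1
        refine (mul_le_mul f1 g1 g0 (by positivity)).trans (le_of_eq ?_)
        ring
      · simp only [h, if_false, mul_zero, Finset.sum_const_zero, zero_add] at f1 g1 ⊢
        refine (mul_le_mul f1 g1 g0 (by positivity)).trans (le_of_eq ?_)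
        ring
    rw [e1]
    refine (Finset.sum_le_sum fun i hi => Finset.sum_le_sum fun i' hi' => e2 i hi i' hi').trans
      (le_of_eq ?_)
    simp only [Finset.sum_add_distrib]
    congr 1
    · rw [Finset.mul_sum, Finset.mul_sum, ← Finset.sum_add_distrib]
      refine Finset.sum_congr rfl fun i hi => ?_
      rw [Finset.sum_ite_eq, if_pos hi]
    · rw [hμ, mul_pow, sq (∑ i ∈ I, r i ^ 2), Finset.sum_mul_sum]
      simp_rw [Finset.mul_sum]
      refine Finset.sum_congr rfl fun i hi => Finset.sum_congr rfl fun i' hi' => ?_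
      ring
  have hone : EE w a (fun _ => EE w b (fun _ => (1 : ℝ))) = 1 := by
    rw [EE_one hw, EE_one hw]
  calc _ = EE w a (fun Φ => EE w b (fun Ψ => μ ^ 2 *
      if (∑ i ∈ I, (∑ j, f i (Φ j)) * ∑ j, g i (Ψ j)) = 0 then 1 else 0)) := by
        simp_rw [EE_mul]
        ring
    _ ≤ EE w a (fun Φ => EE w b (fun Ψ =>
        ((∑ i ∈ I, (∑ j, f i (Φ j)) * ∑ j, g i (Ψ j)) ^ 2 +
          (-2 * μ) * (∑ i ∈ I, (∑ j, f i (Φ j)) * ∑ j, g i (Ψ j))) + μ ^ 2 * 1)) := by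
        refine EE_mono hw0 fun Φ _ => EE_mono hw0 fun Ψ _ => ?_
        split_ifs with h
        · rw [h]; linarith
        · nlinarith [sq_nonneg ((∑ i ∈ I, (∑ j, f i (Φ j)) * ∑ j, g i (Ψ j)) - μ)]
    _ = EE w a (fun Φ => EE w b (fun Ψ =>
          (∑ i ∈ I, (∑ j, f i (Φ j)) * ∑ j, g i (Ψ j)) ^ 2)) + (-2 * μ) * μ + μ ^ 2 * 1 := by
        simp_rw [EE_add, EE_mul]
        rw [hmu1, hone]
    _ ≤ _ := by linarith

lemma PV.w_single {n : ℕ} {p : ℕ → ℝ} (c0 : (Fin n × Bool) × (Fin n × Bool)) :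
    ∑ c, clauseProb2 n p c * (if c = c0 then 1 else 0) = clauseProb2 n p c0 := by
  simp

lemma PV.sat_upper_aux {n : ℕ} {p : ℕ → ℝ} (h : PV n p) (a b : ℕ) (ha : 0 < a) (hb : 0 < b) (t : ℝ)
    (hta : 1 ≤ 12 * t * (a * (p 0 * Real.sqrt (tailS n p) / (4 * defC n p))))
    (htb : 1 ≤ 12 * t * (b * (p 0 * Real.sqrt (tailS n p) / (4 * defC n p)))) :
    probSat2 n (a + b) p ≤ 2 * (144 * t ^ 2 + 24 * t) := by
  have hC := h.defC_pos
  have h0 := h.p0_pos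
  have hTp := h.tail_pos
  have hsq := Real.sq_sqrt hTp.le
  have hs0 := Real.sqrt_pos.2 hTp
  have h0n : 0 < n := by have := h.two; omega
  set s := Real.sqrt (tailS n p) with hs
  set ρ := p 0 * s / (4 * defC n p) with hρ
  have hρ0 : 0 < ρ := by positivity
  let z : Fin n := ⟨0, h0n⟩
  let I : Finset (Fin n) := Finset.univ.filter (fun i => i ≠ z)
  let r : Fin n → ℝ := fun i => (defC n p)⁻¹ / 4 * p 0 * p i
  let f : Bool → Bool → Fin n → (Fin n × Bool) × (Fin n × Bool) → ℝ :=
    fun σ τ i c => if c = ((z, σ), (i, τ)) then 1 else 0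
  have hf0 : ∀ σ τ i c, 0 ≤ f σ τ i c := fun σ τ i c => by
    simp only [f]; split_ifs <;> simp
  have hfr : ∀ σ τ, ∀ i ∈ I, ∑ c, clauseProb2 n p c * f σ τ i c = r i := by
    intro σ τ i hi
    have hi' : i ≠ z := by simpa [I] using hi
    simp only [f]
    rw [PV.w_single]
    simp [clauseProb2, hi'.symm, r, defC, z]
  have hff : ∀ σ τ i i' c, f σ τ i c * f σ τ i' c = if i = i' then f σ τ i c else 0 := by
    intro σ τ i i' c
    simp only [f]
    by_cases hi : i = i'
    · subst hi; simp
    · rw [if_neg hi]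
      by_cases hc : c = ((z, σ), (i, τ))
      · subst hc
        simp [hi]
      · simp [hc]
  have hsumI : ∑ i ∈ I, p i ^ 2 = tailS n p := by
    have h1 := h.split
    rw [Finset.sum_range] at h1
    have h2 : I = Finset.univ.erase z := by
      ext i; simp [I]
    have h3 := Finset.add_sum_erase Finset.univ (fun i : Fin n => p i ^ 2) (Finset.mem_univ z)
    rw [h2]
    simp only [z] at h3 ⊢
    linarith
  have hR2 : ∑ i ∈ I, r i ^ 2 = ρ ^ 2 := by
    have : ∀ i ∈ I, r i ^ 2 = ((defC n p)⁻¹ / 4 * p 0) ^ 2 * p i ^ 2 := fun i _ => by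
      simp only [r]; ring
    rw [Finset.sum_congr rfl this, ← Finset.mul_sum, hsumI, ← hsq, hρ]
    field_simp
  have hr0 : ∀ i, 0 ≤ r i := fun i => by
    have := h.pos i i.2
    simp only [r]; positivity
  have hR3 : ∑ i ∈ I, r i ^ 3 ≤ ρ ^ 3 := by
    have h1 : ∀ i ∈ I, r i ^ 3 ≤ ρ * r i ^ 2 := by
      intro i hi
      have : r i ^ 2 ≤ ρ ^ 2 := by
        rw [← hR2]
        exact Finset.single_le_sum (f := fun i => r i ^ 2) (fun j _ => sq_nonneg _) hi
      have h2 : r i ≤ ρ := (sq_le_sq₀ (hr0 i) hρ0.le).1 this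
      calc r i ^ 3 = r i * r i ^ 2 := by ring
        _ ≤ ρ * r i ^ 2 := by gcongr
    refine (Finset.sum_le_sum h1).trans (le_of_eq ?_)
    rw [← Finset.mul_sum, hR2]; ring
  have haR : (0 : ℝ) < a := Nat.cast_pos.2 ha
  have hbR : (0 : ℝ) < b := Nat.cast_pos.2 hb
  let P : Bool → ℝ := fun σ => EE (clauseProb2 n p) a (fun Φ => EE (clauseProb2 n p) b (fun Ψ =>
      if (∑ i ∈ I, (∑ j, f σ true i (Φ j)) * ∑ j, f σ false i (Ψ j)) = 0 then 1 else 0))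
  have hP : ∀ σ, P σ ≤ 144 * t ^ 2 + 24 * t := by
    intro σ
    have hc := cheb h.w_sum h.w_nonneg a b I (f σ true) (f σ false) r (hf0 σ true) (hf0 σ false)
      (hfr σ true) (hfr σ false) (hff σ true) (hff σ false)
    rw [hR2] at hc
    have hc2 : P σ * (a * b * ρ ^ 2) ^ 2 ≤ a * b * ρ ^ 2 + (a * b ^ 2 + a ^ 2 * b) * ρ ^ 3 := by
      refine hc.trans ?_
      gcongr
    have hu : 1 / (a * ρ) ≤ 12 * t := by
      rw [div_le_iff₀ (by positivity)]; exact hta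
    have hv : 1 / (b * ρ) ≤ 12 * t := by
      rw [div_le_iff₀ (by positivity)]; exact htb
    have ht0 : 0 ≤ 12 * t := le_trans (by positivity) hu
    have h1 : P σ ≤ 1 / (a * ρ) * (1 / (b * ρ)) + 1 / (a * ρ) + 1 / (b * ρ) := by
      rw [← le_div_iff₀ (by positivity)] at hc2
      refine hc2.trans (le_of_eq ?_)
      field_simp
      ring
    have h2 : 1 / (a * ρ) * (1 / (b * ρ)) ≤ 12 * t * (12 * t) :=
      mul_le_mul hu hv (by positivity) ht0
    nlinarith
  have hle : probSat2 n (a + b) p ≤ P true + P false := by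
    rw [probSat_eq, EE_append]
    simp only [P]
    simp_rw [← EE_add]
    refine EE_mono h.w_nonneg fun Φ _ => EE_mono h.w_nonneg fun Ψ _ => ?_
    have hnn : ∀ q : Prop, [Decidable q] → (0 : ℝ) ≤ if q then 1 else 0 := fun q _ => by
      split_ifs <;> simp
    by_cases hsat : Sat2 (Fin.append Φ Ψ)
    · rw [if_pos hsat]
      obtain ⟨A, hA⟩ := hsat
      have key : ∀ σ, A z = !σ →
          (∑ i ∈ I, (∑ j, f σ true i (Φ j)) * ∑ j, f σ false i (Ψ j)) = 0 := by
        intro σ hσ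
        refine Finset.sum_eq_zero fun i _ => ?_
        cases hAi : A i
        · apply mul_eq_zero_of_left
          refine Finset.sum_eq_zero fun j _ => ?_
          simp only [f]
          rw [if_neg]
          intro hc
          have := hA (Fin.castAdd b j)
          rw [Fin.append_left, hc] at this
          simp [hσ, hAi] at this
        · apply mul_eq_zero_of_right
          refine Finset.sum_eq_zero fun j _ => ?_
          simp only [f]
          rw [if_neg]
          intro hc
          have := hA (Fin.natAdd a j)
          rw [Fin.append_right, hc] at this
          simp [hσ, hAi] at this
      cases hz : A z
      · rw [if_pos (key true (by simp [hz]))]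
        exact le_add_of_nonneg_right (hnn _)
      · rw [if_pos (key false (by simp [hz]))]
        exact le_add_of_nonneg_left (hnn _)
    · rw [if_neg hsat]
      exact add_nonneg (hnn _) (hnn _)
  have := hP true
  have := hP false
  linarith

lemma PV.sat_upper {n : ℕ} {p : ℕ → ℝ} (h : PV n p) (m : ℕ) (t : ℝ) (ht0 : 0 ≤ t)
    (ht : defC n p ≤ t * (m * (p 0 * Real.sqrt (tailS n p)))) :
    probSat2 n m p ≤ 2 * (144 * t ^ 2 + 24 * t) := by
  have hC := h.defC_pos
  have hs0 := h.sq_pos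
  have h2 := h.defC_ge
  by_cases hm : 2 ≤ m
  · have hq : 1 ≤ 4 * t * (m * (p 0 * Real.sqrt (tailS n p) / (4 * defC n p))) := by
      have : 4 * t * (m * (p 0 * Real.sqrt (tailS n p) / (4 * defC n p))) =
        t * (m * (p 0 * Real.sqrt (tailS n p))) / defC n p := by field_simp
      rw [this, le_div_iff₀ hC]
      linarith
    have hρ : 0 ≤ p 0 * Real.sqrt (tailS n p) / (4 * defC n p) := by positivity
    have ha : (m : ℝ) ≤ 3 * (m / 2 : ℕ) := by
      have : m ≤ 3 * (m / 2) := by omega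
      exact_mod_cast this
    have hb : (m : ℝ) ≤ 3 * (m - m / 2 : ℕ) := by
      have : m ≤ 3 * (m - m / 2) := by omega
      exact_mod_cast this
    have hab : m = m / 2 + (m - m / 2) := by omega
    rw [hab]
    refine h.sat_upper_aux (m / 2) (m - m / 2) (by omega) (by omega) t ?_ ?_
    · refine hq.trans ?_
      calc _ ≤ 4 * t * (3 * (m / 2 : ℕ) * (p 0 * Real.sqrt (tailS n p) / (4 * defC n p))) := by gcongr
        _ = _ := by ring
    · refine hq.trans ?_
      calc _ ≤ 4 * t * (3 * (m - m / 2 : ℕ) * (p 0 * Real.sqrt (tailS n p) / (4 * defC n p))) := by gcongr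
        _ = _ := by ring
  · have hm1 : (m : ℝ) ≤ 1 := by
      have : m ≤ 1 := by omega
      exact_mod_cast this
    have ht1 : 1 ≤ t := by
      by_contra hc
      push Not at hc
      have : t * (m * (p 0 * Real.sqrt (tailS n p))) ≤ 1 * (1 * (p 0 * Real.sqrt (tailS n p))) := by
        gcongr
      linarith
    refine (h.sat_le_one m).trans ?_
    nlinarith

lemma PV.ms_eq {p : ℕ → ℕ → ℝ} {n : ℕ} :
    mstarCoarse p n = defC n (p n) / (p n 0 * Real.sqrt (tailS n (p n))) := rfl

lemma PV.two_le_ms {p : ℕ → ℕ → ℝ} {n : ℕ} (h : PV n (p n)) : 2 ≤ mstarCoarse p n := by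
  rw [PV.ms_eq, le_div_iff₀ h.sq_pos]
  exact h.defC_ge

lemma PV.low {p : ℕ → ℕ → ℝ} {n : ℕ} (h : PV n (p n)) {D u : ℝ} (hD : 1 ≤ D)
    (hT : Real.sqrt (tailS n (p n)) ≤ D * p n 0) (hu : u ≤ 1 / 4) {m : ℕ}
    (hm : (m : ℝ) ≤ u / D * mstarCoarse p n) : 1 - 6 * u ^ 2 ≤ probSat2 n m (p n) := by
  have hD0 : D ≠ 0 := by linarith
  have e : D * (u / D) = u := by field_simp
  have := h.sat_lower m D (u / D) hD hT ?_ (by rw [e]; exact hu)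
  · rwa [e] at this
  · have hs := h.sq_pos
    rw [PV.ms_eq, mul_div_assoc', le_div_iff₀ hs] at hm
    exact hm

lemma PV.high {p : ℕ → ℕ → ℝ} {n : ℕ} (h : PV n (p n)) {t : ℝ} (ht : 0 ≤ t) {m : ℕ}
    (hm : mstarCoarse p n ≤ t * m) : probSat2 n m (p n) ≤ 2 * (144 * t ^ 2 + 24 * t) := by
  refine h.sat_upper m t ht ?_
  rw [PV.ms_eq, div_le_iff₀ h.sq_pos] at hm
  linarith

/-- Non-uniform random 2-SAT with `p₁² = Θ(∑ pᵢ²)` has a coarse satisfiability threshold at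
`m*(n) = (1 - ∑_{i=1}^n pᵢ²)/(p₁·(∑_{i=2}^n pᵢ²)^{1/2})`: formulas with `m = o(m*)` clauses
are satisfiable whp, formulas with `m = ω(m*)` clauses are unsatisfiable whp, and for some
choice `m(n) = Θ(m*(n))` the satisfiability probability is bounded away from 0 and 1. -/
theorem nonuniform_2SAT_coarse_threshold
    (p : ℕ → ℕ → ℝ) (hp : ProbEnsemble p)
    (hΘ : (fun n => p n 0 ^ 2) =Θ[atTop] fun n => ∑ i ∈ Finset.range n, p n i ^ 2) :
    (∀ m : ℕ → ℕ,
      (fun n => (m n : ℝ)) =o[atTop] (fun n => mstarCoarse p n) →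
      Tendsto (fun n => probSat2 n (m n) (p n)) atTop (nhds 1)) ∧
    (∀ m : ℕ → ℕ,
      (fun n => mstarCoarse p n) =o[atTop] (fun n => (m n : ℝ)) →
      Tendsto (fun n => probSat2 n (m n) (p n)) atTop (nhds 0)) ∧
    (∃ c₁ c₂ : ℝ, 0 < c₁ ∧ c₁ ≤ c₂ ∧ ∃ m : ℕ → ℕ,
      (∀ᶠ n in atTop, c₁ * mstarCoarse p n ≤ (m n : ℝ) ∧ (m n : ℝ) ≤ c₂ * mstarCoarse p n) ∧
      ∃ δ : ℝ, 0 < δ ∧ ∀ᶠ n in atTop,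
        δ ≤ probSat2 n (m n) (p n) ∧ probSat2 n (m n) (p n) ≤ 1 - δ) := by
  have hPV : ∀ᶠ n in atTop, PV n (p n) := by
    filter_upwards [eventually_ge_atTop 2] with n hn
    obtain ⟨h1, h2, h3⟩ := hp n (by omega)
    exact ⟨hn, h1, h2, h3⟩
  obtain ⟨D, hD, hT⟩ : ∃ D : ℝ, 1 ≤ D ∧
      ∀ᶠ n in atTop, Real.sqrt (tailS n (p n)) ≤ D * p n 0 := by
    obtain ⟨c, hc, hb⟩ := hΘ.2.exists_pos
    refine ⟨max 1 (Real.sqrt c), le_max_left _ _, ?_⟩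
    filter_upwards [hPV, hb.bound] with n hn hbn
    have h0 := hn.p0_pos
    have hT := hn.tail_pos
    rw [Real.norm_of_nonneg (Finset.sum_nonneg fun i _ => sq_nonneg _),
      Real.norm_of_nonneg (sq_nonneg _), hn.split] at hbn
    calc Real.sqrt (tailS n (p n)) ≤ Real.sqrt (c * p n 0 ^ 2) :=
          Real.sqrt_le_sqrt (by nlinarith)
      _ = Real.sqrt c * p n 0 := by rw [Real.sqrt_mul hc.le, Real.sqrt_sq h0.le]
      _ ≤ _ := by gcongr; exact le_max_right _ _
  have hD0 : 0 < D := by linarith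
  refine ⟨?_, ?_, ?_⟩
  · intro m hm
    rw [Metric.tendsto_nhds]
    intro ε hε
    set u := min (1 / 4) (ε / 12) with hu
    have hu0 : 0 < u := lt_min (by norm_num) (by positivity)
    have hu1 : u ≤ 1 / 4 := min_le_left _ _
    have hu2 : u ≤ ε / 12 := min_le_right _ _
    filter_upwards [hPV, hT, hm.bound (div_pos hu0 hD0)] with n hn hTn hb
    have hms := hn.two_le_ms
    rw [Real.norm_of_nonneg (Nat.cast_nonneg _), Real.norm_of_nonneg (by linarith)] at hb
    have h1 := hn.low hD hTn hu1 hb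
    have h2 := hn.sat_le_one (m n)
    rw [Real.dist_eq, abs_lt]
    constructor <;> nlinarith
  · intro m hm
    rw [Metric.tendsto_nhds]
    intro ε hε
    set t := min 1 (ε / 1000) with ht
    have ht0 : 0 < t := lt_min (by norm_num) (by positivity)
    have ht1 : t ≤ 1 := min_le_left _ _
    have ht2 : t ≤ ε / 1000 := min_le_right _ _
    filter_upwards [hPV, hm.bound ht0] with n hn hb
    have hms := hn.two_le_ms
    rw [Real.norm_of_nonneg (Nat.cast_nonneg _), Real.norm_of_nonneg (by linarith)] at hb
    have h1 := hn.high ht0.le hb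
    have h2 := hn.sat_nonneg (m n)
    rw [Real.dist_eq, abs_lt]
    constructor <;> nlinarith
  · refine ⟨1 / 4 / D, 1001, by positivity, ?_, fun n =>
      if h : ∃ m, probSat2 n m (p n) ≤ 1 / 2 then Nat.find h else 0, ?_⟩
    · rw [div_le_iff₀ hD0]; linarith
    have key : ∀ᶠ n in atTop, ∃ m : ℕ,
        (if h : ∃ m, probSat2 n m (p n) ≤ 1 / 2 then Nat.find h else 0) = m ∧
        1 / 4 / D * mstarCoarse p n ≤ m ∧ (m : ℝ) ≤ 1001 * mstarCoarse p n ∧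
        3 / 8 ≤ probSat2 n m (p n) ∧ probSat2 n m (p n) ≤ 1 - 3 / 8 := by
      filter_upwards [hPV, hT] with n hn hTn
      have hms := hn.two_le_ms
      have hhigh : ∀ m : ℕ, 1000 * mstarCoarse p n ≤ m → probSat2 n m (p n) ≤ 1 / 2 := by
        intro m hm
        have := hn.high (t := 1 / 1000) (by norm_num) (m := m) (by linarith)
        norm_num at this ⊢
        linarith
      have hex : ∃ m, probSat2 n m (p n) ≤ 1 / 2 :=
        ⟨⌈1000 * mstarCoarse p n⌉₊, hhigh _ (Nat.le_ceil _)⟩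
      refine ⟨Nat.find hex, by rw [dif_pos hex], ?_⟩
      have hspec := Nat.find_spec hex
      have hmin : ∀ k < Nat.find hex, ¬ probSat2 n k (p n) ≤ 1 / 2 := fun k hk => Nat.find_min hex hk
      generalize Nat.find hex = M at hspec hmin
      have hM : M ≠ 0 := by
        rintro rfl
        rw [hn.sat_zero] at hspec
        norm_num at hspec
      obtain ⟨k, rfl⟩ := Nat.exists_eq_succ_of_ne_zero hM
      have hk := hmin k (Nat.lt_succ_self k)
      have hsucc := hn.sat_succ k
      refine ⟨?_, ?_, ?_, by linarith⟩
      · by_contra hc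
        push Not at hc
        have := hn.low hD hTn (le_refl (1 / 4)) hc.le
        norm_num at this hspec
        linarith
      · have : (k : ℝ) < 1000 * mstarCoarse p n := by
          by_contra hc
          push Not at hc
          exact hk (hhigh k hc)
        push_cast
        linarith
      · push Not at hk
        simp only [Nat.succ_eq_add_one] at *
        linarith
    refine ⟨?_, 3 / 8, by norm_num, ?_⟩
    · filter_upwards [key] with n ⟨m, h1, h2, h3, _, _⟩
      rw [h1]
      exact ⟨h2, h3⟩
    · filter_upwards [key] with n ⟨m, h1, _, _, h4, h5⟩
      rw [h1]
      exact ⟨h4, h5⟩
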